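/- Let Φ ∈ ℝ^{M×N} have unit-norm columns (‖φ_i‖₂ = 1 for all i) and satisfy the restricted isometry property of order K with constant δ ∈ (0,1). Let x ∈ ℝ^N have support T with |T| = K and let y = Φx. Then max_{t ∈ T} |⟨φ_t, y⟩| ≤ √(1 + δ²) · ‖x‖₂. -/

import Mathlib

open Finset

/-- The Euclidean (ℓ²) norm of a vector in ℝⁿ. -/
noncomputable def l2norm {n : ℕ} (v : Fin n → ℝ) : ℝ := Real.sqrt (∑ i, v i ^ 2)

/-- The Euclidean inner product on ℝᵐ. -/
noncomputable def dot {m : ℕ} (u v : Fin m → ℝ) : ℝ := ∑ k, u k * v k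

/-- `x` has at most `s` nonzero entries. -/
noncomputable def sparse {n : ℕ} (s : ℕ) (x : Fin n → ℝ) : Prop :=
  (Finset.univ.filter (fun i => x i ≠ 0)).card ≤ s

/-- `Φ` satisfies the restricted isometry property of order `s` with constant `δ`. -/
noncomputable def RIP {M N : ℕ} (Φ : Matrix (Fin M) (Fin N) ℝ) (s : ℕ) (δ : ℝ) : Prop :=
  ∀ x : Fin N → ℝ, sparse s x →
    (1 - δ) * l2norm x ^ 2 ≤ l2norm (Φ.mulVec x) ^ 2 ∧
    l2norm (Φ.mulVec x) ^ 2 ≤ (1 + δ) * l2norm x ^ 2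

theorem l2norm_sq' {n : ℕ} (v : Fin n → ℝ) : l2norm v ^ 2 = ∑ i, v i ^ 2 :=
  Real.sq_sqrt (Finset.sum_nonneg fun i _ => sq_nonneg (v i))

theorem mulVec_update' {M N : ℕ} (Φ : Matrix (Fin M) (Fin N) ℝ) (x : Fin N → ℝ)
    (t : Fin N) (a : ℝ) (k : Fin M) :
    Φ.mulVec (Function.update x t a) k
      = Φ k t * a + Φ.mulVec (Function.update x t 0) k := by
  simp only [Matrix.mulVec, dotProduct]
  rw [← Finset.add_sum_erase _ _ (Finset.mem_univ t),
    ← Finset.add_sum_erase univ (fun i => Φ k i * Function.update x t 0 i) (Finset.mem_univ t)]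
  simp only [Function.update_self, mul_zero, zero_add]
  congr 1
  apply Finset.sum_congr rfl
  intro i hi
  rw [Function.update_of_ne (Finset.ne_of_mem_erase hi),
    Function.update_of_ne (Finset.ne_of_mem_erase hi)]

theorem sum_update' {N : ℕ} (x : Fin N → ℝ) (t : Fin N) (a : ℝ) :
    ∑ i, Function.update x t a i ^ 2 = a ^ 2 + ∑ i, Function.update x t 0 i ^ 2 := by
  rw [← Finset.add_sum_erase _ _ (Finset.mem_univ t),
    ← Finset.add_sum_erase univ (fun i => Function.update x t 0 i ^ 2) (Finset.mem_univ t)]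
  simp only [Function.update_self, ne_eq, OfNat.ofNat_ne_zero, not_false_eq_true, zero_pow,
    zero_add]
  congr 1
  apply Finset.sum_congr rfl
  intro i hi
  rw [Function.update_of_ne (Finset.ne_of_mem_erase hi),
    Function.update_of_ne (Finset.ne_of_mem_erase hi)]

/-- inequality (25): if `Φ` has unit-norm columns and RIP of order `K`
with constant `δ ∈ (0,1)`, `x` has support `T` with `|T| = K`, and `y = Φx`, then
`max_{t ∈ T} |⟨φ_t, y⟩| ≤ √(1 + δ²)·‖x‖₂`. -/
theorem stmt_16 {M N : ℕ} (K : ℕ) (Φ : Matrix (Fin M) (Fin N) ℝ)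
    (hcols : ∀ i : Fin N, l2norm (fun k => Φ k i) = 1)
    (δ : ℝ) (hδ0 : 0 < δ) (hδ1 : δ < 1) (hRIP : RIP Φ K δ)
    (x : Fin N → ℝ) (T : Finset (Fin N))
    (hT : ∀ i, x i ≠ 0 ↔ i ∈ T) (hTcard : T.card = K)
    (y : Fin M → ℝ) (hy : y = Φ.mulVec x) :
    (⨆ t : T, |dot (fun k => Φ k (t : Fin N)) y|) ≤
      Real.sqrt (1 + δ ^ 2) * l2norm x := by
  have hnn : 0 ≤ Real.sqrt (1 + δ ^ 2) * l2norm x :=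
    mul_nonneg (Real.sqrt_nonneg _) (Real.sqrt_nonneg _)
  refine Real.iSup_le (fun ⟨t, ht⟩ => ?_) hnn
  refine abs_le_of_sq_le_sq ?_ hnn
  rw [mul_pow, Real.sq_sqrt (by positivity), l2norm_sq']
  have hcol : ∑ k, Φ k t ^ 2 = 1 := by
    rw [← l2norm_sq' (fun k => Φ k t), hcols t]; norm_num
  set w := Φ.mulVec (Function.update x t 0) with hw
  set S := ∑ i, Function.update x t 0 i ^ 2 with hS
  set c := ∑ k, Φ k t * w k with hc
  have hx : ∑ i, x i ^ 2 = x t ^ 2 + S := by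
    have := sum_update' x t (x t)
    rwa [Function.update_eq_self] at this
  have hdot : dot (fun k => Φ k t) y = x t + c := by
    have h : ∀ k, y k = Φ k t * x t + w k := fun k => by
      have := mulVec_update' Φ x t (x t) k
      rwa [Function.update_eq_self, ← hy] at this
    simp only [dot, h, mul_add, Finset.sum_add_distrib, ← mul_assoc, ← pow_two]
    rw [← Finset.sum_mul, hcol, one_mul]
  have hsp : ∀ a, sparse K (Function.update x t a) := fun a => by
    unfold sparse
    rw [← hTcard]
    apply Finset.card_le_card
    intro i hi
    by_cases h : i = t
    · exact h ▸ ht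
    · simpa [Function.update_of_ne h, ← hT] using hi
  have hn : ∀ a, l2norm (Φ.mulVec (Function.update x t a)) ^ 2
      = a ^ 2 + 2 * a * c + ∑ k, w k ^ 2 := fun a => by
    rw [l2norm_sq']
    have : ∀ k, (Φ.mulVec (Function.update x t a) k) ^ 2
        = Φ k t ^ 2 * a ^ 2 + 2 * a * (Φ k t * w k) + w k ^ 2 := fun k => by
      rw [mulVec_update']; ring
    simp only [this, Finset.sum_add_distrib, ← Finset.mul_sum, ← Finset.sum_mul, hcol, one_mul,
      ← hc]
  have hpol : ∀ a, 2 * a * c ≤ δ * (a ^ 2 + S) := fun a => by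
    have h1 := (hRIP _ (hsp a)).2
    have h2 := (hRIP _ (hsp (-a))).1
    rw [hn, l2norm_sq', sum_update'] at h1 h2
    linarith
  have hcS : c ^ 2 / δ ^ 2 ≤ S := by
    have h := hpol (c / δ)
    have e : 2 * (c / δ) * c = δ * (2 * (c ^ 2 / δ ^ 2)) := by field_simp
    rw [e, div_pow] at h
    have := le_of_mul_le_mul_left h hδ0
    linarith
  have hcS2 : c ^ 2 ≤ δ ^ 2 * S := by
    rw [div_le_iff₀ (by positivity)] at hcS
    linarith
  have hyoung : 2 * x t * c ≤ δ ^ 2 * x t ^ 2 + c ^ 2 / δ ^ 2 := by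
    have h := sq_nonneg (δ * x t - c / δ)
    have e : (δ * x t - c / δ) ^ 2 = δ ^ 2 * x t ^ 2 + c ^ 2 / δ ^ 2 - 2 * x t * c := by
      field_simp
      ring
    linarith
  rw [hdot, hx]
  nlinarith
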